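/- arXiv:1401.5499 — 4 statements merged into one kernel-verified Lean document; each statement's English description precedes it below -/
import Mathlib

section
/- Let V be a finite type, let Γ be a quiver on V with no directed cycles of positive length (every directed path in Γ from a vertex to itself has length zero), and let A be an associative unital ring equipped with a complete family of orthogonal idempotents (e_v)_{v∈V} (so e_v·e_v = e_v, e_v·e_w = 0 for v ≠ w, and Σ_{v∈V} e_v = 1). Assume: (i) for every v, every element of e_v·A·e_v is an integer multiple of e_v; and (ii) for all v ≠ w, if e_v·A·e_w ≠ 0 then there is a directed path of positive length from v to w in Γ. Then for every right A-module P there exist an enumeration v_1, …, v_k of V in which every arrow of Γ with source v_i has target among v_1, …, v_{i−1}, and a chain of A-submodules 0 = P_0 ≤ P_1 ≤ ⋯ ≤ P_k = P, such that for each i: (a) the quotient P_i/P_{i−1} is isomorphic as an abelian group to the subgroup P·e_{v_i} = {p·e_{v_i} : p ∈ P} of P; and (b) for every a ∈ A there is an integer n with e_{v_i}·a·e_{v_i} = n·e_{v_i}, and a acts on P_i/P_{i−1} by multiplication by n. -/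
open MulOpposite

/-- The vertices of a finite acyclic quiver can be enumerated so that every path of positive length
strictly decreases the index. -/
theorem exists_equiv_fin_lt_of_path {V : Type*} [Fintype V] [Quiver V]
    (hacyclic : ∀ (v : V) (p : Quiver.Path v v), p.length = 0) :
    ∃ v : Fin (Fintype.card V) ≃ V,
      ∀ (i j) (p : Quiver.Path (v i) (v j)), 0 < p.length → j < i := by
  let r : V → V → Prop := fun a b => Nonempty (Quiver.Path b a)
  have : IsPartialOrder V r :=
    { refl := fun a => ⟨Quiver.Path.nil⟩
      trans := fun a b c ⟨p⟩ ⟨q⟩ => ⟨q.comp p⟩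
      antisymm := fun a b ⟨p⟩ ⟨q⟩ => by
        have h := hacyclic _ (p.comp q)
        rw [Quiver.Path.length_comp] at h
        exact (p.eq_of_length_zero (by omega)).symm }
  obtain ⟨s, hs, hrs⟩ := extend_partialOrder r
  let : LinearOrder V :=
    { le := s
      le_refl := hs.refl
      le_trans := hs.trans
      le_antisymm := hs.antisymm
      le_total := hs.total
      toDecidableLE := Classical.decRel _ }
  let v := monoEquivOfFin V rfl
  refine ⟨v.toEquiv, fun i j p hp => lt_of_le_of_ne (v.le_iff_le.1 (hrs _ _ ⟨p⟩)) ?_⟩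
  rintro rfl
  exact hp.ne' (hacyclic _ p)

section Filtration

variable {A : Type*} [Ring A] {n : ℕ} {e : Fin n → A}
  {P : Type*} [AddCommGroup P] [Module Aᵐᵒᵖ P]

/-- Expansion of `p·a·e_k` along the decomposition `p = ∑ j, p·e_j`. -/
theorem CompleteOrthogonalIdempotents.op_mul_smul_eq_sum (he : CompleteOrthogonalIdempotents e)
    (a : A) (k : Fin n) (p : P) :
    op (a * e k) • p = ∑ j, op (e j * a * e k) • p := by
  rw [← Finset.sum_smul, ← Finset.op_sum, ← Finset.sum_mul, ← Finset.sum_mul, he.complete, one_mul]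

/-- For a family of idempotents that is triangular, in the sense that `e_j·A·e_k = 0` for `j < k`,
the submodule of the elements killed by all `e_k` with `m ≤ k`. -/
def idempotentFiltration (he : CompleteOrthogonalIdempotents e)
    (htri : ∀ j k, j < k → ∀ a, e j * a * e k = 0) (P : Type*) [AddCommGroup P] [Module Aᵐᵒᵖ P]
    (m : ℕ) : Submodule Aᵐᵒᵖ P where
  carrier := {p | ∀ k : Fin n, m ≤ k → op (e k) • p = 0}
  zero_mem' := fun k _ => smul_zero _
  add_mem' := fun {p q} hp hq k hk => by rw [smul_add, hp k hk, hq k hk, add_zero]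
  smul_mem' := fun a p hp k hk => by
    rw [← mul_smul, ← op_unop a, ← op_mul, he.op_mul_smul_eq_sum]
    refine Finset.sum_eq_zero fun j _ => ?_
    rcases lt_or_ge j k with h | h
    · rw [htri j k h, op_zero, zero_smul]
    · rw [mul_assoc, op_mul, mul_smul, hp j (hk.trans h), smul_zero]

variable (he : CompleteOrthogonalIdempotents e) (htri : ∀ j k, j < k → ∀ a, e j * a * e k = 0)

theorem idempotentFiltration_mono : Monotone (idempotentFiltration he htri P) :=
  fun _ _ h _ hp k hk => hp k (h.trans hk)

theorem idempotentFiltration_zero : idempotentFiltration he htri P 0 = ⊥ := by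
  refine (Submodule.eq_bot_iff _).2 fun p hp => ?_
  rw [← one_smul Aᵐᵒᵖ p, ← op_one, ← he.complete, Finset.op_sum, Finset.sum_smul]
  exact Finset.sum_eq_zero fun k _ => hp k (Nat.zero_le _)

theorem idempotentFiltration_top : idempotentFiltration he htri P n = ⊤ :=
  eq_top_iff.2 fun _ _ k hk => absurd k.isLt hk.not_gt

theorem mem_idempotentFiltration_iff_of_mem_succ {i : Fin n} {p : P}
    (hp : p ∈ idempotentFiltration he htri P (i + 1)) :
    p ∈ idempotentFiltration he htri P i ↔ op (e i) • p = 0 := by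
  refine ⟨fun h => h i le_rfl, fun h k hk => ?_⟩
  rcases hk.eq_or_lt with hk | hk
  · rwa [← Fin.ext hk]
  · exact hp k hk

theorem op_smul_mem_idempotentFiltration (i : Fin n) (p : P) :
    op (e i) • p ∈ idempotentFiltration he htri P (i + 1) := fun k hk => by
  rw [← mul_smul, ← op_mul, he.ortho (Fin.ne_of_lt hk), op_zero, zero_smul]

/-- The `i`-th subquotient of the filtration is isomorphic to `P·e_i`. -/
theorem nonempty_idempotentFiltration_quotient_addEquiv (i : Fin n) :
    Nonempty ((idempotentFiltration he htri P (i + 1) ⧸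
        (idempotentFiltration he htri P i).comap (idempotentFiltration he htri P (i + 1)).subtype) ≃+
      (DistribSMul.toAddMonoidHom P (op (e i))).range) := by
  let N := idempotentFiltration he htri P (i + 1)
  let φ : N →+ (DistribSMul.toAddMonoidHom P (op (e i))).range :=
    (DistribSMul.toAddMonoidHom P (op (e i))).rangeRestrict.comp N.subtype.toAddMonoidHom
  have hker : ((idempotentFiltration he htri P i).comap N.subtype).toAddSubgroup = φ.ker := by
    ext p
    rw [AddMonoidHom.mem_ker, Subtype.ext_iff]
    exact mem_idempotentFiltration_iff_of_mem_succ he htri p.2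
  have hsurj : Function.Surjective φ := by
    rintro ⟨_, p, rfl⟩
    refine ⟨⟨op (e i) • p, op_smul_mem_idempotentFiltration he htri i p⟩, Subtype.ext ?_⟩
    change op (e i) • op (e i) • p = op (e i) • p
    rw [← mul_smul, ← op_mul, he.idem i]
  exact ⟨(QuotientAddGroup.quotientAddEquivOfEq hker).trans
    (QuotientAddGroup.quotientKerEquivOfSurjective φ hsurj)⟩

/-- If `e_i·a·e_i = z·e_i`, then `a` acts by `z` on the `i`-th subquotient of the filtration. -/
theorem op_smul_idempotentFiltration_quotient {i : Fin n} {a : A} {z : ℤ}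
    (hz : e i * a * e i = z • e i)
    (x : idempotentFiltration he htri P (i + 1) ⧸
      (idempotentFiltration he htri P i).comap (idempotentFiltration he htri P (i + 1)).subtype) :
    op a • x = z • x := by
  obtain ⟨p, rfl⟩ := Submodule.Quotient.mk_surjective _ x
  rw [← Submodule.Quotient.mk_smul, ← Submodule.Quotient.mk_smul, Submodule.Quotient.eq,
    Submodule.mem_comap, Submodule.subtype_apply,
    mem_idempotentFiltration_iff_of_mem_succ he htri (Subtype.prop _)]
  have hsum : op (a * e i) • (p : P) = op (e i * a * e i) • (p : P) := by
    rw [he.op_mul_smul_eq_sum]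
    refine Finset.sum_eq_single_of_mem i (Finset.mem_univ i) fun j _ hj => ?_
    rcases lt_or_gt_of_ne hj with h | h
    · rw [htri j i h, op_zero, zero_smul]
    · rw [mul_assoc, op_mul, mul_smul, p.2 j h, smul_zero]
  rw [Submodule.coe_sub, Submodule.coe_smul, Submodule.coe_smul_of_tower, smul_sub, ← mul_smul,
    ← op_mul, hsum, hz, op_smul, smul_assoc, smul_comm, sub_self]

end Filtration

/-- Jordan–Hölder-type filtration for right modules over a ring with a
complete family of orthogonal idempotents indexed by the vertices of a finite acyclic
quiver, where `e_v·A·e_v` consists of integer multiples of `e_v` and `e_v·A·e_w ≠ 0`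
(for `v ≠ w`) forces a positive-length path from `v` to `w`.  Right modules over `A`
are formalized as modules over `Aᵐᵒᵖ`, with right action `p·a = op a • p`. -/
theorem stmt_0 {V : Type*} [Fintype V] [Quiver V]
    (hacyclic : ∀ (v : V) (p : Quiver.Path v v), p.length = 0)
    {A : Type*} [Ring A] (e : V → A)
    (hidem : ∀ v, e v * e v = e v)
    (horth : ∀ v w, v ≠ w → e v * e w = 0)
    (hsum : ∑ v : V, e v = 1)
    (hdiag : ∀ (v : V) (a : A), ∃ n : ℤ, e v * a * e v = n • e v)
    (hpath : ∀ v w : V, v ≠ w → (∃ a : A, e v * a * e w ≠ 0) →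
      ∃ p : Quiver.Path v w, 0 < p.length)
    (P : Type*) [AddCommGroup P] [Module Aᵐᵒᵖ P] :
    ∃ (v : Fin (Fintype.card V) ≃ V)
      (F : Fin (Fintype.card V + 1) → Submodule Aᵐᵒᵖ P),
      (∀ i j : Fin (Fintype.card V), Nonempty (v i ⟶ v j) → j < i) ∧
      Monotone F ∧ F 0 = ⊥ ∧ F (Fin.last (Fintype.card V)) = ⊤ ∧
      ∀ i : Fin (Fintype.card V),
        Nonempty
          ((↥(F i.succ) ⧸ (F i.castSucc).comap (F i.succ).subtype) ≃+
            ↥(DistribMulAction.toAddMonoidHom P (MulOpposite.op (e (v i)))).range) ∧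
        ∀ a : A, ∃ n : ℤ, e (v i) * a * e (v i) = n • e (v i) ∧
          ∀ x : ↥(F i.succ) ⧸ (F i.castSucc).comap (F i.succ).subtype,
            MulOpposite.op a • x = n • x := by
  obtain ⟨v, hv⟩ := exists_equiv_fin_lt_of_path hacyclic
  have he : CompleteOrthogonalIdempotents (e ∘ v) :=
    { idem := fun i => hidem (v i)
      ortho := fun i j hij => horth _ _ (v.injective.ne hij)
      complete := (Equiv.sum_comp v e).trans hsum }
  have htri : ∀ j k, j < k → ∀ a, (e ∘ v) j * a * (e ∘ v) k = 0 := fun j k hjk a => by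
    by_contra h
    obtain ⟨p, hp⟩ := hpath _ _ (v.injective.ne hjk.ne) ⟨a, h⟩
    exact hjk.asymm (hv j k p hp)
  refine ⟨v, fun i => idempotentFiltration he htri P i, fun i j ⟨f⟩ => hv i j f.toPath one_pos,
    fun i j hij => idempotentFiltration_mono he htri hij, idempotentFiltration_zero he htri,
    idempotentFiltration_top he htri,
    fun i => ⟨nonempty_idempotentFiltration_quotient_addEquiv he htri i, fun a => ?_⟩⟩
  obtain ⟨z, hz⟩ := hdiag (v i) a
  exact ⟨z, hz, op_smul_idempotentFiltration_quotient he htri hz⟩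
end

section
/- Let V be a finite type, let Γ be a quiver on V with no directed cycles of positive length (every directed path in Γ from a vertex to itself has length zero), and let A be an associative unital ring equipped with a complete family of orthogonal idempotents (e_v)_{v∈V} (so e_v·e_v = e_v, e_v·e_w = 0 for v ≠ w, and Σ_{v∈V} e_v = 1). Assume: (i) for every v, every element of e_v·A·e_v is an integer multiple of e_v; and (ii) for all v ≠ w, if e_v·A·e_w ≠ 0 then there is a directed path of positive length from v to w in Γ. Fix v ∈ V and assume moreover that the additive subgroup generated by e_v is infinite cyclic (e_v ≠ 0 and k·e_v = 0 implies k = 0). Then the function n_v : A → ℤ determined by e_v·a·e_v = n_v(a)·e_v is a unital ring homomorphism: n_v(1) = 1, n_v(a + b) = n_v(a) + n_v(b), and n_v(a·b) = n_v(a)·n_v(b) for all a, b ∈ A. -/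
/-- Under the hypotheses of the acyclic-quiver idempotent setup, if the
additive subgroup generated by `e_v` is infinite cyclic, then the integer-valued
function `n_v` determined by `e_v·a·e_v = n_v(a)·e_v` is a unital ring homomorphism. -/
theorem stmt_3 {V : Type*} [Fintype V] [Quiver V]
    (hacyclic : ∀ (v : V) (p : Quiver.Path v v), p.length = 0)
    {A : Type*} [Ring A] (e : V → A)
    (hidem : ∀ v, e v * e v = e v)
    (horth : ∀ v w, v ≠ w → e v * e w = 0)
    (hsum : ∑ v : V, e v = 1)
    (hdiag : ∀ (v : V) (a : A), ∃ n : ℤ, e v * a * e v = n • e v)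
    (hpath : ∀ v w : V, v ≠ w → (∃ a : A, e v * a * e w ≠ 0) →
      ∃ p : Quiver.Path v w, 0 < p.length)
    (v : V) (hnz : e v ≠ 0) (hinf : ∀ k : ℤ, k • e v = 0 → k = 0)
    (n : A → ℤ) (hn : ∀ a : A, e v * a * e v = n a • e v) :
    n 1 = 1 ∧ (∀ a b : A, n (a + b) = n a + n b) ∧
      ∀ a b : A, n (a * b) = n a * n b := by
  have inj : ∀ {k l : ℤ}, k • e v = l • e v → k = l := fun {k l} h =>
    sub_eq_zero.mp (hinf _ (by rw [sub_smul, h, sub_self]))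
  have cross : ∀ (a b : A) (w : V), w ≠ v → e v * a * e w * (b * e v) = 0 := by
    intro a b w hw
    by_cases ha : e v * a * e w = 0
    · rw [ha, zero_mul]
    by_cases hb : e w * b * e v = 0
    · rw [mul_assoc, ← mul_assoc (e w), hb, mul_zero]
    obtain ⟨p, hp⟩ := hpath v w hw.symm ⟨a, ha⟩
    obtain ⟨q, -⟩ := hpath w v hw ⟨b, hb⟩
    have hpq := hacyclic v (p.comp q)
    rw [Quiver.Path.length_comp] at hpq
    omega
  refine ⟨inj ?_, fun a b => inj ?_, fun a b => inj ?_⟩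
  · rw [← hn, mul_one, hidem, one_smul]
  · rw [← hn, mul_add, add_mul, hn, hn, add_smul]
  · calc n (a * b) • e v = e v * a * (∑ w, e w) * (b * e v) := by
          rw [← hn, hsum]
          simp only [mul_one, mul_assoc]
      _ = ∑ w, e v * a * e w * (b * e v) := by
          rw [Finset.mul_sum, Finset.sum_mul]
      _ = e v * a * e v * (b * e v) :=
          Finset.sum_eq_single v (fun w _ hw => cross a b w hw)
            (fun h => absurd (Finset.mem_univ v) h)
      _ = (n a * n b) • e v := by
          rw [hn, smul_mul_assoc, ← mul_assoc, hn, smul_smul]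
end

section
/- A perfect matching of the set {1,…,2n} is a fixed-point-free involution m of {1,…,2n}; it is noncrossing if there are no indices a < b < c < d with m(a) = c and m(b) = d. A decorated cleaved link of order n is a triple (m_in, m_out, σ) where m_in and m_out are noncrossing perfect matchings of {1,…,2n} and σ assigns an element of {+,−} to each orbit of the subgroup of permutations generated by m_in and m_out (these orbits are called the circles). For n = 2, the two noncrossing perfect matchings of {1,2,3,4} are α (matching 1↔2 and 3↔4) and β (matching 1↔4 and 2↔3), and the twelve decorated cleaved links of order 2 are A_± = (β, α, ±) and D_± = (α, β, ±), each with one circle, and B_{ε₁ε₂} = (β, β, σ) and C_{ε₁ε₂} = (α, α, σ), each with two circles, where ε₁ ∈ {+,−} is the decoration σ gives the circle containing 1 and ε₂ the decoration of the other circle. Let ρ be the cyclic rotation of {1,2,3,4} with ρ(1) = 4, ρ(2) = 1, ρ(3) = 2, ρ(4) = 3, acting on decorated cleaved links by (m_in, m_out, σ) ↦ (ρ∘m_in∘ρ⁻¹, ρ∘m_out∘ρ⁻¹, σ∘ρ⁻¹) (the decoration of a circle O of the image is the decoration of the circle ρ⁻¹(O)). Then ρ² fixes exactly ten of the twelve decorated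 cleaved links of order 2 and exchanges the remaining two pairs: B_{+−} ↔ B_{−+} and C_{+−} ↔ C_{−+}. -/
/-- A noncrossing perfect matching of `{1,…,k}`: a fixed-point-free involutive
permutation of `Fin k` with no indices `a < b < c < d` satisfying `m a = c` and
`m b = d`. -/
def IsNCPM {k : ℕ} (m : Equiv.Perm (Fin k)) : Prop :=
  (∀ i, m (m i) = i) ∧ (∀ i, m i ≠ i) ∧
    ∀ a b c d : Fin k, a < b → b < c → c < d → m a = c → m b = d → False

instance {k : ℕ} (m : Equiv.Perm (Fin k)) : Decidable (IsNCPM m) := by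
  unfold IsNCPM; infer_instance

/-- The circles of a pair of matchings: the orbits of the subgroup of permutations
generated by `m₁` and `m₂`. -/
abbrev Circles {k : ℕ} (m₁ m₂ : Equiv.Perm (Fin k)) : Type :=
  MulAction.orbitRel.Quotient
    (Subgroup.closure {m₁, m₂} : Subgroup (Equiv.Perm (Fin k))) (Fin k)

/-- A decorated cleaved link on `k = 2n` boundary points. -/
structure DCL (k : ℕ) where
  mIn : Equiv.Perm (Fin k)
  mOut : Equiv.Perm (Fin k)
  hIn : IsNCPM mIn
  hOut : IsNCPM mOut
  deco : Circles mIn mOut → Bool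

/-- The noncrossing matching `α` of `{1,2,3,4}`, matching `1↔2` and `3↔4`
(zero-indexed: `0↔1`, `2↔3`). -/
def mα : Equiv.Perm (Fin 4) := ⟨![1, 0, 3, 2], ![1, 0, 3, 2], by decide, by decide⟩

/-- The noncrossing matching `β` of `{1,2,3,4}`, matching `1↔4` and `2↔3`
(zero-indexed: `0↔3`, `1↔2`). -/
def mβ : Equiv.Perm (Fin 4) := ⟨![3, 2, 1, 0], ![3, 2, 1, 0], by decide, by decide⟩

/-- The cyclic rotation `ρ` with `ρ(1)=4, ρ(2)=1, ρ(3)=2, ρ(4)=3`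
(zero-indexed: `i ↦ i - 1 mod 4`). -/
def ρ : Equiv.Perm (Fin 4) := ⟨![3, 0, 1, 2], ![1, 2, 3, 0], by decide, by decide⟩

open Classical in
/-- The decoration assigning `ε₁` to the circle containing the point `1`
(zero-indexed `0`) and `ε₂` to every other circle. -/
noncomputable def mkDeco (m₁ m₂ : Equiv.Perm (Fin 4)) (ε₁ ε₂ : Bool) :
    Circles m₁ m₂ → Bool :=
  fun c => if c = Quotient.mk (MulAction.orbitRel _ _) (0 : Fin 4) then ε₁ else ε₂

/-- The generators `A_±` (inside matching `β`, outside matching `α`, one circle). -/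
noncomputable def genA (ε : Bool) : DCL 4 :=
  ⟨mβ, mα, by decide, by decide, mkDeco mβ mα ε ε⟩

/-- The generators `D_±` (inside matching `α`, outside matching `β`, one circle). -/
noncomputable def genD (ε : Bool) : DCL 4 :=
  ⟨mα, mβ, by decide, by decide, mkDeco mα mβ ε ε⟩

/-- The generators `B_{ε₁ε₂}` (inside and outside matching `β`, two circles;
`ε₁` decorates the circle containing the point `1`). -/
noncomputable def genB (ε₁ ε₂ : Bool) : DCL 4 :=
  ⟨mβ, mβ, by decide, by decide, mkDeco mβ mβ ε₁ ε₂⟩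

/-- The generators `C_{ε₁ε₂}` (inside and outside matching `α`, two circles;
`ε₁` decorates the circle containing the point `1`). -/
noncomputable def genC (ε₁ ε₂ : Bool) : DCL 4 :=
  ⟨mα, mα, by decide, by decide, mkDeco mα mα ε₁ ε₂⟩

/-- The action of a rotation `g` on a decorated cleaved link: both matchings are
conjugated by `g`, and the decoration of a circle `O` of the image is the decoration
of the circle `g⁻¹(O)`. -/
noncomputable def rotate (g : Equiv.Perm (Fin 4)) (L : DCL 4)
    (h₁ : IsNCPM (g * L.mIn * g⁻¹)) (h₂ : IsNCPM (g * L.mOut * g⁻¹)) : DCL 4 where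
  mIn := g * L.mIn * g⁻¹
  mOut := g * L.mOut * g⁻¹
  hIn := h₁
  hOut := h₂
  deco := fun c => L.deco (Quotient.mk (MulAction.orbitRel _ _) (g⁻¹ c.out))

theorem DCL.ext_mk {k : ℕ} {L L' : DCL k} (hIn : L.mIn = L'.mIn) (hOut : L.mOut = L'.mOut)
    (h : ∀ x : Fin k, L.deco (Quotient.mk (MulAction.orbitRel _ _) x) =
      L'.deco (Quotient.mk (MulAction.orbitRel _ _) x)) : L = L' := by
  obtain ⟨m₁, m₂, _, _, σ⟩ := L
  obtain ⟨m₁', m₂', _, _, σ'⟩ := L'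
  obtain rfl : m₁ = m₁' := hIn
  obtain rfl : m₂ = m₂' := hOut
  obtain rfl : σ = σ' := funext fun c => Quotient.inductionOn c h
  rfl

theorem inv_mul_mul_mem_closure_pair {G : Type*} [Group G] {g a b x : G}
    (hx : x ∈ Subgroup.closure {g * a * g⁻¹, g * b * g⁻¹}) :
    g⁻¹ * x * g ∈ Subgroup.closure {a, b} := by
  induction hx using Subgroup.closure_induction with
  | mem y hy =>
    apply Subgroup.subset_closure
    obtain rfl | rfl := hy
    · left; group
    · right; simp only [Set.mem_singleton_iff]; group
  | one => simp
  | mul y z _ _ hy hz => simpa [mul_assoc] using mul_mem hy hz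
  | inv y _ hy => simpa [mul_assoc] using inv_mem hy

theorem rotate_deco_mk (g : Equiv.Perm (Fin 4)) (L : DCL 4)
    (h₁ : IsNCPM (g * L.mIn * g⁻¹)) (h₂ : IsNCPM (g * L.mOut * g⁻¹)) (x : Fin 4) :
    (rotate g L h₁ h₂).deco (Quotient.mk (MulAction.orbitRel _ _) x) =
      L.deco (Quotient.mk (MulAction.orbitRel _ _) (g⁻¹ x)) := by
  obtain ⟨⟨y, hy⟩, hyx⟩ : (Quotient.mk (MulAction.orbitRel
      (Subgroup.closure {g * L.mIn * g⁻¹, g * L.mOut * g⁻¹}) (Fin 4)) x).out ∈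
      MulAction.orbit _ x := Quotient.mk_out (s := MulAction.orbitRel _ _) x
  refine congrArg L.deco (Quotient.sound ⟨⟨_, inv_mul_mul_mem_closure_pair hy⟩, ?_⟩)
  refine Eq.trans ?_ (congrArg (g⁻¹ : Equiv.Perm (Fin 4)) hyx)
  simp [Subgroup.smul_def]

/-- The circle through `0` of a doubled matching `m` consists of `0` and `m 0`. -/
theorem mkDeco_self_mk {m : Equiv.Perm (Fin 4)} (hm : ∀ i, m (m i) = i) (ε₁ ε₂ : Bool)
    (x : Fin 4) :
    mkDeco m m ε₁ ε₂ (Quotient.mk (MulAction.orbitRel _ _) x) =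
      if x = 0 ∨ x = m 0 then ε₁ else ε₂ := by
  classical
  simp only [mkDeco]
  refine if_congr ?_ rfl rfl
  rw [Quotient.eq]
  constructor
  · rintro ⟨⟨y, hy⟩, rfl⟩
    rw [Set.pair_eq_singleton, Subgroup.mem_closure_singleton] at hy
    obtain ⟨n, rfl⟩ := hy
    have hsq : m ^ (2 : ℤ) = 1 := by
      ext i; simp [zpow_ofNat, pow_two, hm]
    obtain ⟨j, rfl | rfl⟩ := n.even_or_odd'
    · left; simp [Subgroup.smul_def, zpow_mul, hsq]
    · right; simp [Subgroup.smul_def, zpow_add, zpow_mul, hsq]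
  · rintro (rfl | rfl)
    · exact MulAction.mem_orbit_self _
    · exact ⟨⟨m, Subgroup.subset_closure (Set.mem_insert _ _)⟩, rfl⟩

theorem mkDeco_const (m₁ m₂ : Equiv.Perm (Fin 4)) (ε : Bool) (c : Circles m₁ m₂) :
    mkDeco m₁ m₂ ε ε c = ε :=
  ite_self _

theorem genB_deco_mk (ε₁ ε₂ : Bool) (x : Fin 4) :
    (genB ε₁ ε₂).deco (Quotient.mk (MulAction.orbitRel _ _) x) =
      if x = 0 ∨ x = mβ 0 then ε₁ else ε₂ :=
  mkDeco_self_mk (show IsNCPM mβ by decide).1 ε₁ ε₂ x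

theorem genC_deco_mk (ε₁ ε₂ : Bool) (x : Fin 4) :
    (genC ε₁ ε₂).deco (Quotient.mk (MulAction.orbitRel _ _) x) =
      if x = 0 ∨ x = mα 0 then ε₁ else ε₂ :=
  mkDeco_self_mk (show IsNCPM mα by decide).1 ε₁ ε₂ x

theorem rho_sq_conj_mα : (ρ * ρ) * mα * (ρ * ρ)⁻¹ = mα := by decide

theorem rho_sq_conj_mβ : (ρ * ρ) * mβ * (ρ * ρ)⁻¹ = mβ := by decide

/-- moving the marked point two segments counter-clockwise, i.e.
acting by the rotation `ρ²`, fixes exactly ten of the twelve decorated cleaved links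
of order 2 (namely `A_±`, `D_±`, `B_{++}`, `B_{--}`, `C_{++}`, `C_{--}`) and
exchanges the remaining two pairs `B_{+-} ↔ B_{-+}` and `C_{+-} ↔ C_{-+}`.  All
twelve images are recorded uniformly by `B_{ε₁ε₂} ↦ B_{ε₂ε₁}` and
`C_{ε₁ε₂} ↦ C_{ε₂ε₁}`; the disequalities express that the last two pairs are
genuinely exchanged rather than fixed. -/
theorem stmt_5 :
    (∀ ε₁ ε₂ : Bool,
      rotate (ρ * ρ) (genA ε₁) (show IsNCPM ((ρ * ρ) * mβ * (ρ * ρ)⁻¹) by decide)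
          (show IsNCPM ((ρ * ρ) * mα * (ρ * ρ)⁻¹) by decide) = genA ε₁ ∧
      rotate (ρ * ρ) (genD ε₁) (show IsNCPM ((ρ * ρ) * mα * (ρ * ρ)⁻¹) by decide)
          (show IsNCPM ((ρ * ρ) * mβ * (ρ * ρ)⁻¹) by decide) = genD ε₁ ∧
      rotate (ρ * ρ) (genB ε₁ ε₂) (show IsNCPM ((ρ * ρ) * mβ * (ρ * ρ)⁻¹) by decide)
          (show IsNCPM ((ρ * ρ) * mβ * (ρ * ρ)⁻¹) by decide) = genB ε₂ ε₁ ∧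
      rotate (ρ * ρ) (genC ε₁ ε₂) (show IsNCPM ((ρ * ρ) * mα * (ρ * ρ)⁻¹) by decide)
          (show IsNCPM ((ρ * ρ) * mα * (ρ * ρ)⁻¹) by decide) = genC ε₂ ε₁) ∧
    genB true false ≠ genB false true ∧ genC true false ≠ genC false true := by
  refine ⟨fun ε₁ ε₂ => ⟨?_, ?_, ?_, ?_⟩, fun h => ?_, fun h => ?_⟩
  · refine DCL.ext_mk rho_sq_conj_mβ rho_sq_conj_mα fun x => ?_
    exact (mkDeco_const _ _ _ _).trans (mkDeco_const _ _ _ _).symm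
  · refine DCL.ext_mk rho_sq_conj_mα rho_sq_conj_mβ fun x => ?_
    exact (mkDeco_const _ _ _ _).trans (mkDeco_const _ _ _ _).symm
  · refine DCL.ext_mk rho_sq_conj_mβ rho_sq_conj_mβ fun x => ?_
    refine (rotate_deco_mk _ _ _ _ x).trans
      ((genB_deco_mk _ _ _).trans (Eq.trans ?_ (genB_deco_mk _ _ _).symm))
    decide +revert
  · refine DCL.ext_mk rho_sq_conj_mα rho_sq_conj_mα fun x => ?_
    refine (rotate_deco_mk _ _ _ _ x).trans
      ((genC_deco_mk _ _ _).trans (Eq.trans ?_ (genC_deco_mk _ _ _).symm))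
    decide +revert
  · have h0 := congrArg (fun L : DCL 4 => L.deco (Quotient.mk (MulAction.orbitRel _ _) 0)) h
    simp [genB_deco_mk] at h0
  · have h0 := congrArg (fun L : DCL 4 => L.deco (Quotient.mk (MulAction.orbitRel _ _) 0)) h
    simp [genC_deco_mk] at h0
end

section
/- Let S be a finite type and let m₁ and m₂ be fixed-point-free involutive permutations of S. Then: (a) every orbit of the subgroup of permutations of S generated by m₁ and m₂ has even cardinality; (b) m₁ maps every orbit of the permutation m₁∘m₂ bijectively onto an orbit of m₁∘m₂ disjoint from it, and each orbit of the subgroup generated by m₁ and m₂ is the disjoint union of exactly two orbits of m₁∘m₂, which are interchanged by m₁; consequently the number of orbits of m₁∘m₂ on S is exactly twice the number of orbits of the subgroup generated by m₁ and m₂. -/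
open MulAction Equiv.Perm

section FixedPointFreeInvolutions

variable {S : Type*} {m₁ m₂ : Equiv.Perm S}

theorem mem_orbit_zpowers_iff_sameCycle {r : Equiv.Perm S} {x y : S} :
    y ∈ orbit (Subgroup.zpowers r) x ↔ r.SameCycle x y := by
  constructor
  · rintro ⟨⟨_, k, rfl⟩, rfl⟩
    exact ⟨k, rfl⟩
  · rintro ⟨k, rfl⟩
    exact ⟨⟨r ^ k, k, rfl⟩, rfl⟩

theorem apply_zpow_mul_of_involutive (h₁ : Function.Involutive m₁) (h₂ : Function.Involutive m₂)
    (k : ℤ) (x : S) : m₁ (((m₁ * m₂) ^ k) x) = ((m₁ * m₂) ^ (-k)) (m₁ x) := by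
  have h₁' : m₁⁻¹ = m₁ := Equiv.ext fun x => inv_eq_iff_eq.2 (h₁ x).symm
  have h₂' : m₂⁻¹ = m₂ := Equiv.ext fun x => inv_eq_iff_eq.2 (h₂ x).symm
  have conj : m₁ * (m₁ * m₂) * m₁⁻¹ = (m₁ * m₂)⁻¹ := by
    rw [mul_inv_rev, h₁', h₂']
    ext x
    simp [h₁ (m₂ (m₁ x))]
  have hk := congrArg (· ^ k) conj
  simp only [conj_zpow, inv_zpow'] at hk
  rw [← hk]
  simp

theorem sameCycle_mul_apply_iff (h₁ : Function.Involutive m₁) (h₂ : Function.Involutive m₂)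
    {x y : S} : (m₁ * m₂).SameCycle (m₁ x) (m₁ y) ↔ (m₁ * m₂).SameCycle x y := by
  have key {x y : S} (h : (m₁ * m₂).SameCycle x y) : (m₁ * m₂).SameCycle (m₁ x) (m₁ y) := by
    obtain ⟨k, rfl⟩ := h
    exact ⟨-k, (apply_zpow_mul_of_involutive h₁ h₂ k x).symm⟩
  exact ⟨fun h => by simpa only [h₁ x, h₁ y] using key h, key⟩

/-- A power of `m₁ * m₂` taking `x` to `m₁ x` yields, at its midpoint, a fixed point of `m₁` or of
`m₂`, according to the parity of the exponent. -/
theorem not_sameCycle_mul_apply (h₁ : Function.Involutive m₁) (h₂ : Function.Involutive m₂)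
    (h₁fpf : ∀ x, m₁ x ≠ x) (h₂fpf : ∀ x, m₂ x ≠ x) (x : S) :
    ¬ (m₁ * m₂).SameCycle x (m₁ x) := by
  rintro ⟨k, hk⟩
  have shift (j : ℤ) : m₁ (((m₁ * m₂) ^ j) x) = ((m₁ * m₂) ^ (-j + k)) x := by
    rw [apply_zpow_mul_of_involutive h₁ h₂, ← hk, zpow_add, mul_apply]
  obtain ⟨j, rfl | rfl⟩ := k.even_or_odd'
  · apply h₁fpf (((m₁ * m₂) ^ j) x)
    rw [shift]
    congr 2
    ring
  · apply h₂fpf (((m₁ * m₂) ^ j) x)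
    apply m₁.injective
    rw [shift, show -j + (2 * j + 1) = 1 + j by ring, zpow_add, zpow_one]
    rfl

theorem mem_orbit_closure_pair_iff (h₁ : Function.Involutive m₁) (h₂ : Function.Involutive m₂)
    {x y : S} : y ∈ orbit (Subgroup.closure {m₁, m₂}) x ↔
      (m₁ * m₂).SameCycle x y ∨ (m₁ * m₂).SameCycle (m₁ x) y := by
  have hm₁ : m₁ ∈ Subgroup.closure {m₁, m₂} := Subgroup.subset_closure (by simp)
  have hm₂ : m₂ ∈ Subgroup.closure {m₁, m₂} := Subgroup.subset_closure (by simp)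
  constructor
  · rintro ⟨⟨g, hg⟩, rfl⟩
    change (m₁ * m₂).SameCycle x (g x) ∨ (m₁ * m₂).SameCycle (m₁ x) (g x)
    have step₁ (y : S) (h : (m₁ * m₂).SameCycle x y ∨ (m₁ * m₂).SameCycle (m₁ x) y) :
        (m₁ * m₂).SameCycle x (m₁ y) ∨ (m₁ * m₂).SameCycle (m₁ x) (m₁ y) := by
      rw [sameCycle_mul_apply_iff h₁ h₂, ← sameCycle_mul_apply_iff h₁ h₂ (y := m₁ y), h₁ y]
      exact h.symm
    have step₂ (y : S) (h : (m₁ * m₂).SameCycle x y ∨ (m₁ * m₂).SameCycle (m₁ x) y) :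
        (m₁ * m₂).SameCycle x (m₂ y) ∨ (m₁ * m₂).SameCycle (m₁ x) (m₂ y) := by
      have h' := step₁ y h
      rw [← h₂ y, ← mul_apply, sameCycle_apply_right, sameCycle_apply_right] at h'
      exact h'
    induction hg using Subgroup.closure_induction_left with
    | one => exact Or.inl (SameCycle.refl _ _)
    | mul_left g hg k hk ih =>
      rcases hg with rfl | rfl
      exacts [step₁ _ ih, step₂ _ ih]
    | inv_mul_cancel g hg k hk ih =>
      rcases hg with rfl | rfl
      · rw [show g⁻¹ = g from Equiv.ext fun x => inv_eq_iff_eq.2 (h₁ x).symm]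
        exact step₁ _ ih
      · rw [show g⁻¹ = g from Equiv.ext fun x => inv_eq_iff_eq.2 (h₂ x).symm]
        exact step₂ _ ih
  · rintro (⟨k, rfl⟩ | ⟨k, rfl⟩)
    · exact ⟨⟨_, zpow_mem (mul_mem hm₁ hm₂) k⟩, rfl⟩
    · exact ⟨⟨_, mul_mem (zpow_mem (mul_mem hm₁ hm₂) k) hm₁⟩, rfl⟩

theorem image_orbit_zpowers_mul (h₁ : Function.Involutive m₁) (h₂ : Function.Involutive m₂)
    (x : S) : m₁ '' orbit (Subgroup.zpowers (m₁ * m₂)) x =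
      orbit (Subgroup.zpowers (m₁ * m₂)) (m₁ x) := by
  ext y
  rw [h₁.image_eq_preimage_symm, Set.mem_preimage, mem_orbit_zpowers_iff_sameCycle,
    mem_orbit_zpowers_iff_sameCycle, ← sameCycle_mul_apply_iff h₁ h₂, h₁ y]

theorem disjoint_orbit_zpowers_mul (h₁ : Function.Involutive m₁) (h₂ : Function.Involutive m₂)
    (h₁fpf : ∀ x, m₁ x ≠ x) (h₂fpf : ∀ x, m₂ x ≠ x) (x : S) :
    Disjoint (orbit (Subgroup.zpowers (m₁ * m₂)) x)
      (orbit (Subgroup.zpowers (m₁ * m₂)) (m₁ x)) := by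
  rw [Set.disjoint_left]
  intro y hx hy
  rw [mem_orbit_zpowers_iff_sameCycle] at hx hy
  exact not_sameCycle_mul_apply h₁ h₂ h₁fpf h₂fpf x (hx.trans hy.symm)

theorem orbit_closure_pair_eq_union (h₁ : Function.Involutive m₁) (h₂ : Function.Involutive m₂)
    (x : S) : orbit (Subgroup.closure {m₁, m₂}) x =
      orbit (Subgroup.zpowers (m₁ * m₂)) x ∪ orbit (Subgroup.zpowers (m₁ * m₂)) (m₁ x) := by
  ext y
  rw [mem_orbit_closure_pair_iff h₁ h₂, Set.mem_union, mem_orbit_zpowers_iff_sameCycle,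
    mem_orbit_zpowers_iff_sameCycle]

theorem even_card_orbit_closure_pair [Finite S] (h₁ : Function.Involutive m₁)
    (h₂ : Function.Involutive m₂) (h₁fpf : ∀ x, m₁ x ≠ x) (h₂fpf : ∀ x, m₂ x ≠ x) (x : S) :
    Even (Nat.card (orbit (Subgroup.closure {m₁, m₂}) x)) := by
  rw [Nat.card_coe_set_eq, orbit_closure_pair_eq_union h₁ h₂,
    Set.ncard_union_eq (disjoint_orbit_zpowers_mul h₁ h₂ h₁fpf h₂fpf x),
    ← image_orbit_zpowers_mul h₁ h₂, Set.ncard_image_of_injective _ m₁.injective]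
  exact ⟨_, rfl⟩

theorem card_orbitRel_quotient_zpowers_mul [Finite S] (h₁ : Function.Involutive m₁)
    (h₂ : Function.Involutive m₂) (h₁fpf : ∀ x, m₁ x ≠ x) (h₂fpf : ∀ x, m₂ x ≠ x) :
    Nat.card (orbitRel.Quotient (Subgroup.zpowers (m₁ * m₂)) S) =
      2 * Nat.card (orbitRel.Quotient (Subgroup.closure {m₁, m₂}) S) := by
  have mk_eq_iff {x y : S} :
      (Quotient.mk _ y : orbitRel.Quotient (Subgroup.zpowers (m₁ * m₂)) S) = Quotient.mk _ x ↔
        (m₁ * m₂).SameCycle x y := by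
    rw [Quotient.eq, orbitRel_apply, mem_orbit_zpowers_iff_sameCycle]
  have mk_eq_iff' {x y : S} :
      (Quotient.mk _ y : orbitRel.Quotient (Subgroup.closure {m₁, m₂}) S) = Quotient.mk _ x ↔
        (m₁ * m₂).SameCycle x y ∨ (m₁ * m₂).SameCycle (m₁ x) y := by
    rw [Quotient.eq, orbitRel_apply, mem_orbit_closure_pair_iff h₁ h₂]
  let π : orbitRel.Quotient (Subgroup.zpowers (m₁ * m₂)) S →
      orbitRel.Quotient (Subgroup.closure {m₁, m₂}) S :=
    Quotient.map' id fun x y h => by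
      rw [id, id, orbitRel_apply, mem_orbit_closure_pair_iff h₁ h₂]
      exact Or.inl (mem_orbit_zpowers_iff_sameCycle.1 (orbitRel_apply.1 h))
  have card_fiber (q) : Nat.card {p // π p = q} = 2 := by
    induction q using Quotient.inductionOn with | _ x
    have fiber_eq : {p | π p = Quotient.mk _ x} = {Quotient.mk _ x, Quotient.mk _ (m₁ x)} := by
      ext p
      induction p using Quotient.inductionOn with | _ y
      rw [Set.mem_insert_iff, Set.mem_singleton_iff, mk_eq_iff, mk_eq_iff]
      exact mk_eq_iff'
    rw [← Set.coe_ofPred, Nat.card_coe_set_eq, fiber_eq, Set.ncard_pair]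
    rw [ne_comm, Ne, mk_eq_iff]
    exact not_sameCycle_mul_apply h₁ h₂ h₁fpf h₂fpf x
  have : Fintype (orbitRel.Quotient (Subgroup.closure {m₁, m₂}) S) := Fintype.ofFinite _
  rw [← Nat.card_congr (Equiv.sigmaFiberEquiv π), Nat.card_sigma]
  simp [card_fiber, mul_comm]

end FixedPointFreeInvolutions

/-- For two fixed-point-free involutive permutations `m₁, m₂` of a finite
type `S`: (a) every orbit of the subgroup generated by `m₁` and `m₂` has even
cardinality; (b) `m₁` maps every orbit of `m₁ ∘ m₂` bijectively onto a disjoint orbit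
of `m₁ ∘ m₂`, each orbit of the generated subgroup is the disjoint union of exactly
two such orbits interchanged by `m₁`, and consequently the number of orbits of
`m₁ ∘ m₂` is twice the number of orbits of the generated subgroup. -/
theorem stmt_8 {S : Type*} [Fintype S] (m₁ m₂ : Equiv.Perm S)
    (h₁inv : ∀ x, m₁ (m₁ x) = x) (h₁fpf : ∀ x, m₁ x ≠ x)
    (h₂inv : ∀ x, m₂ (m₂ x) = x) (h₂fpf : ∀ x, m₂ x ≠ x) :
    (∀ x : S,
      Even (Nat.card
        (MulAction.orbit (Subgroup.closure {m₁, m₂} : Subgroup (Equiv.Perm S)) x))) ∧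
    (∀ x : S,
      (⇑m₁ '' MulAction.orbit (Subgroup.zpowers (m₁ * m₂)) x
          = MulAction.orbit (Subgroup.zpowers (m₁ * m₂)) (m₁ x)) ∧
      Disjoint (MulAction.orbit (Subgroup.zpowers (m₁ * m₂)) x)
        (MulAction.orbit (Subgroup.zpowers (m₁ * m₂)) (m₁ x)) ∧
      MulAction.orbit (Subgroup.closure {m₁, m₂} : Subgroup (Equiv.Perm S)) x
        = MulAction.orbit (Subgroup.zpowers (m₁ * m₂)) x
            ∪ MulAction.orbit (Subgroup.zpowers (m₁ * m₂)) (m₁ x)) ∧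
    Nat.card (MulAction.orbitRel.Quotient (Subgroup.zpowers (m₁ * m₂)) S)
      = 2 * Nat.card
          (MulAction.orbitRel.Quotient
            (Subgroup.closure {m₁, m₂} : Subgroup (Equiv.Perm S)) S) := by
  exact ⟨even_card_orbit_closure_pair h₁inv h₂inv h₁fpf h₂fpf,
    fun x => ⟨image_orbit_zpowers_mul h₁inv h₂inv x,
      disjoint_orbit_zpowers_mul h₁inv h₂inv h₁fpf h₂fpf x,
      orbit_closure_pair_eq_union h₁inv h₂inv x⟩,
    card_orbitRel_quotient_zpowers_mul h₁inv h₂inv h₁fpf h₂fpf⟩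
end
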